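/- Expander edge-counting bound: Let G(L∪R,E) be an (n, m, d, ℓ, ε)-bipartite expander and let S, T ⊆ L be disjoint sets with |S| + |T| ≤ ℓ. Then the number of edges (x, y) ∈ E with x ∈ T and y ∈ Γ(S) is at most εd(|S| + |T|). -/

import Mathlib

open Classical in
noncomputable def nbrSet {L R D : Type*} [Fintype D] (nbr : L → D → R) (S : Finset L) :
    Finset R :=
  S.biUnion (fun i => Finset.image (nbr i) Finset.univ)

/-- The `(ℓ, ε)`-bipartite-expander property for the `|D|`-left-regular bipartite graph
whose left vertex `i` has neighbours `nbr i j`, `j : D`. -/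
def IsExpander {L R D : Type*} [Fintype D] (ℓ ε : ℝ) (nbr : L → D → R) : Prop :=
  ∀ S : Finset L, (S.card : ℝ) ≤ ℓ →
    (1 - ε) * (Fintype.card D) * S.card ≤ ((nbrSet nbr S).card : ℝ)

theorem mem_nbrSet_iff {L R D : Type*} [Fintype D] (nbr : L → D → R) (S : Finset L) (y : R) :
    y ∈ nbrSet nbr S ↔ ∃ x ∈ S, ∃ j, nbr x j = y := by
  simp [nbrSet]

open Classical in
theorem card_nbrSet_le {L R D : Type*} [Fintype D] (nbr : L → D → R) (S : Finset L) :
    (nbrSet nbr S).card ≤ S.card * Fintype.card D := by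
  unfold nbrSet
  exact Finset.card_biUnion_le_card_mul _ _ _ (fun x _ => Finset.card_image_le)

open Classical in
/-- Expander edge-counting bound: the number of edges from `T` into `Γ(S)` is at most
`εd(|S| + |T|)`.  An edge from `x` is a pair `(x, j)` with `j` ranging over the `d` edge
slots of `x`. -/
theorem expander_edge_counting
    {n m d : ℕ} (ℓ : ℕ) (ε : ℝ)
    (nbr : Fin n → Fin d → Fin m)
    (hexp : IsExpander (ℓ : ℝ) ε nbr)
    (S T : Finset (Fin n)) (hdisj : Disjoint S T)
    (hcard : S.card + T.card ≤ ℓ) :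
    ((∑ x ∈ T, (Finset.univ.filter (fun j : Fin d => nbr x j ∈ nbrSet nbr S)).card : ℕ) : ℝ)
      ≤ ε * d * (S.card + T.card) := by
  have h := hexp (S ∪ T) (by
    rw [Finset.card_union_of_disjoint hdisj]; exact_mod_cast hcard)
  rw [Finset.card_union_of_disjoint hdisj, Fintype.card_fin] at h
  have hS : (nbrSet nbr S).card ≤ S.card * d := by
    simpa using card_nbrSet_le nbr S
  have hsub : nbrSet nbr (S ∪ T) ⊆ nbrSet nbr S ∪
      T.biUnion (fun x => (Finset.univ.filter
        (fun j : Fin d => ¬ nbr x j ∈ nbrSet nbr S)).image (nbr x)) := by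
    intro y hy
    by_cases hyS : y ∈ nbrSet nbr S
    · exact Finset.mem_union_left _ hyS
    · apply Finset.mem_union_right
      obtain ⟨x, hx, j, rfl⟩ := (mem_nbrSet_iff nbr _ _).1 hy
      rcases Finset.mem_union.1 hx with hx | hx
      · exact absurd ((mem_nbrSet_iff nbr _ _).2 ⟨x, hx, j, rfl⟩) hyS
      · exact Finset.mem_biUnion.2 ⟨x, hx, Finset.mem_image.2
          ⟨j, Finset.mem_filter.2 ⟨Finset.mem_univ _, hyS⟩, rfl⟩⟩
  have hT : (T.biUnion (fun x => (Finset.univ.filter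
        (fun j : Fin d => ¬ nbr x j ∈ nbrSet nbr S)).image (nbr x))).card ≤
      ∑ x ∈ T, (Finset.univ.filter (fun j : Fin d => ¬ nbr x j ∈ nbrSet nbr S)).card :=
    Finset.card_biUnion_le.trans (Finset.sum_le_sum fun x _ => Finset.card_image_le)
  have hsum : ∑ x ∈ T, (Finset.univ.filter (fun j : Fin d => nbr x j ∈ nbrSet nbr S)).card +
      ∑ x ∈ T, (Finset.univ.filter (fun j : Fin d => ¬ nbr x j ∈ nbrSet nbr S)).card
      = T.card * d := by
    rw [← Finset.sum_add_distrib, Finset.sum_congr rfl (g := fun _ => d)]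
    · simp
    · intro x _
      rw [Finset.card_filter_add_card_filter_not]
      simp
  have hU := (Finset.card_le_card hsub).trans (Finset.card_union_le _ _)
  have key : (nbrSet nbr (S ∪ T)).card +
      ∑ x ∈ T, (Finset.univ.filter (fun j : Fin d => nbr x j ∈ nbrSet nbr S)).card
      ≤ S.card * d + T.card * d := by omega
  have key' := (Nat.cast_le (α := ℝ)).2 key
  rw [Nat.cast_add] at key'
  push_cast at key' h ⊢
  linarith
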